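/- Local linear margin: Let Φ : ℝ^n → ℝ^m be C¹ with Φ(g₀) = 0 and with L_J-Lipschitz derivative near g₀. If ‖g − g₀‖ ≤ σ_min(J_Φ(g₀))/L_J, then ‖Φ(g)‖ ≥ (1/2) σ_min(J_Φ(g₀)) ‖g − g₀‖. -/

import Mathlib

/-- The smallest singular value of a linear map. -/
noncomputable def sigmaMin {n m : ℕ}
    (M : EuclideanSpace ℝ (Fin n) →L[ℝ] EuclideanSpace ℝ (Fin m)) : ℝ :=
  ⨅ x : {x : EuclideanSpace ℝ (Fin n) // ‖x‖ = 1}, ‖M x.1‖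

theorem sigmaMin_mul_norm_le {n m : ℕ}
    (M : EuclideanSpace ℝ (Fin n) →L[ℝ] EuclideanSpace ℝ (Fin m))
    (v : EuclideanSpace ℝ (Fin n)) : sigmaMin M * ‖v‖ ≤ ‖M v‖ := by
  rcases eq_or_ne v 0 with rfl | hv
  · simp
  have hv' : 0 < ‖v‖ := norm_pos_iff.2 hv
  have hbdd : BddBelow (Set.range fun x : {x : EuclideanSpace ℝ (Fin n) // ‖x‖ = 1} => ‖M x.1‖) :=
    ⟨0, by rintro _ ⟨x, rfl⟩; exact norm_nonneg _⟩
  have h : sigmaMin M ≤ ‖M (‖v‖⁻¹ • v)‖ :=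
    ciInf_le hbdd ⟨‖v‖⁻¹ • v, norm_smul_inv_norm (𝕜 := ℝ) hv⟩
  rw [map_smul, norm_smul, norm_inv, norm_norm, inv_mul_eq_div] at h
  exact (le_div_iff₀ hv').1 h

/-- First-order Taylor estimate when the derivative satisfies a Lipschitz bound based at the
initial point of the segment. -/
theorem norm_sub_sub_fderiv_le_of_lipschitz_segment {E F : Type*}
    [NormedAddCommGroup E] [NormedSpace ℝ E] [NormedAddCommGroup F] [NormedSpace ℝ F]
    {f : E → F} (hf : Differentiable ℝ f) {a b : E} {L : ℝ}
    (hLip : ∀ x ∈ segment ℝ a b, ‖fderiv ℝ f x - fderiv ℝ f a‖ ≤ L * ‖x - a‖) :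
    ‖f b - f a - fderiv ℝ f a (b - a)‖ ≤ L / 2 * ‖b - a‖ ^ 2 := by
  have hderiv (t : ℝ) : HasDerivAt
      (fun t : ℝ => f (a + t • (b - a)) - f a - t • fderiv ℝ f a (b - a))
      ((fderiv ℝ f (a + t • (b - a)) - fderiv ℝ f a) (b - a)) t := by
    have hline : HasDerivAt (fun t : ℝ => a + t • (b - a)) (b - a) t := by
      simpa using ((hasDerivAt_id t).smul_const (b - a)).const_add a
    have hlin : HasDerivAt (fun t : ℝ => t • fderiv ℝ f a (b - a)) (fderiv ℝ f a (b - a)) t := by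
      simpa using (hasDerivAt_id t).smul_const (fderiv ℝ f a (b - a))
    exact (((hf _).hasFDerivAt.comp_hasDerivAt t hline).sub_const (f a)).sub hlin
  have hB (t : ℝ) : HasDerivAt (fun t : ℝ => L / 2 * ‖b - a‖ ^ 2 * t ^ 2)
      (L * t * ‖b - a‖ ^ 2) t := by
    have h := (hasDerivAt_pow 2 t).const_mul (L / 2 * ‖b - a‖ ^ 2)
    exact h.congr_deriv (by push_cast; ring)
  have h := image_norm_le_of_norm_deriv_right_le_deriv_boundary (a := 0) (b := 1)
    (fun t _ => (hderiv t).continuousAt.continuousWithinAt)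
    (fun t _ => (hderiv t).hasDerivWithinAt) (by simp) hB
    (fun t ht => by
      have hmem : a + t • (b - a) ∈ segment ℝ a b := by
        rw [segment_eq_image']
        exact ⟨t, ⟨ht.1, ht.2.le⟩, rfl⟩
      have hJ := hLip _ hmem
      rw [add_sub_cancel_left, norm_smul, Real.norm_of_nonneg ht.1] at hJ
      calc _ ≤ _ := ContinuousLinearMap.le_opNorm _ _
        _ ≤ L * (t * ‖b - a‖) * ‖b - a‖ := by gcongr
        _ = L * t * ‖b - a‖ ^ 2 := by ring)
    (Set.right_mem_Icc.2 zero_le_one)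
  simpa using h

/-- Local linear margin via Lipschitz Jacobian. -/
theorem stmt_8 {n m : ℕ} (hn : 0 < n)
    (Φ : EuclideanSpace ℝ (Fin n) → EuclideanSpace ℝ (Fin m))
    (hΦ : ContDiff ℝ 1 Φ)
    (g₀ : EuclideanSpace ℝ (Fin n)) (hg₀ : Φ g₀ = 0)
    (L : ℝ) (hL : 0 < L)
    (g : EuclideanSpace ℝ (Fin n))
    (hLip : ∀ x ∈ segment ℝ g₀ g, ∀ y ∈ segment ℝ g₀ g,
      ‖fderiv ℝ Φ x - fderiv ℝ Φ y‖ ≤ L * ‖x - y‖)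
    (hball : ‖g - g₀‖ ≤ sigmaMin (fderiv ℝ Φ g₀) / L) :
    (1 / 2) * sigmaMin (fderiv ℝ Φ g₀) * ‖g - g₀‖ ≤ ‖Φ g‖ := by
  have hTaylor := norm_sub_sub_fderiv_le_of_lipschitz_segment
    (hΦ.differentiable one_ne_zero) (fun x hx => hLip x hx g₀ (left_mem_segment ℝ g₀ g))
  rw [hg₀, sub_zero, norm_sub_rev] at hTaylor
  have hσ := sigmaMin_mul_norm_le (fderiv ℝ Φ g₀) (g - g₀)
  have htri := norm_sub_norm_le (fderiv ℝ Φ g₀ (g - g₀)) (Φ g)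
  have hquad := mul_le_mul_of_nonneg_right ((le_div_iff₀ hL).1 hball) (norm_nonneg (g - g₀))
  linarith
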